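/- Consider a wiretapped Tree-PIN source on a tree G = ([m], E): for each edge e ∈ E there is a triple of finite-valued random variables (T_e, Y_e, Z_e), the triples {(T_e, Y_e, Z_e)}_{e∈E} are mutually independent across edges, terminals observe the edge components as in a Tree-PIN source, and the wiretapper observes Z = (Z_e : e ∈ E). Fix an edge e ∈ E and let B_e ⊆ [m] be the vertex set of one connected component of G with edge e removed. Then the conditional mutual information across this cut given the wiretapper's information satisfies I(X_{B_e} ; X_{B_e^c} | Z) = I(T_e ; Y_e | Z_e). -/

import Mathlib

open Finset

/-- Probability that the random variable `X : Ω → α` takes the value `a`,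
for a probability mass function `p` on the finite sample space `Ω`. -/
noncomputable def probOf {Ω α : Type*} [Fintype Ω] [DecidableEq α]
    (p : Ω → ℝ) (X : Ω → α) (a : α) : ℝ :=
  ∑ ω ∈ Finset.univ.filter (fun ω => X ω = a), p ω

/-- Shannon entropy (in nats) of the random variable `X : Ω → α` under the
probability mass function `p`. -/
noncomputable def entropy {Ω α : Type*} [Fintype Ω] [Fintype α] [DecidableEq α]
    (p : Ω → ℝ) (X : Ω → α) : ℝ :=
  ∑ a : α, Real.negMulLog (probOf p X a)

/-- Conditional Shannon entropy `H(X | Y) = H(X, Y) - H(Y)`. -/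
noncomputable def condEntropy {Ω α β : Type*} [Fintype Ω]
    [Fintype α] [DecidableEq α] [Fintype β] [DecidableEq β]
    (p : Ω → ℝ) (X : Ω → α) (Y : Ω → β) : ℝ :=
  entropy p (fun ω => (X ω, Y ω)) - entropy p Y

/-- Mutual information `I(X ; Y) = H(X) + H(Y) - H(X, Y)`. -/
noncomputable def mutualInfo {Ω α β : Type*} [Fintype Ω]
    [Fintype α] [DecidableEq α] [Fintype β] [DecidableEq β]
    (p : Ω → ℝ) (X : Ω → α) (Y : Ω → β) : ℝ :=
  entropy p X + entropy p Y - entropy p (fun ω => (X ω, Y ω))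

/-- Conditional mutual information `I(X ; Y | Z) = H(X|Z) + H(Y|Z) - H(X,Y|Z)`. -/
noncomputable def condMutualInfo {Ω α β γ : Type*} [Fintype Ω]
    [Fintype α] [DecidableEq α] [Fintype β] [DecidableEq β]
    [Fintype γ] [DecidableEq γ]
    (p : Ω → ℝ) (X : Ω → α) (Y : Ω → β) (Z : Ω → γ) : ℝ :=
  condEntropy p X Z + condEntropy p Y Z - condEntropy p (fun ω => (X ω, Y ω)) Z

/-- The undirected simple graph on `[m]` underlying the directed edges
`e ↦ (tl e, hd e)`. -/
def graphOf {m : ℕ} {ε : Type*} (tl hd : ε → Fin m) : SimpleGraph (Fin m) :=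
  SimpleGraph.fromRel (fun i j => ∃ e, tl e = i ∧ hd e = j)

/-- In a Tree-PIN source on the tree with directed edges `e = (tl e, hd e)`, the
variable observed by terminal `k` is the tuple of the components `T_e` for edges `e`
leaving `k` together with the components `Y_e` for edges `e` entering `k`. -/
def termRV {Ω : Type*} {m : ℕ} {ε : Type*} (tl hd : ε → Fin m)
    {Tt Yt : ε → Type*} (Te : ∀ e, Ω → Tt e) (Ye : ∀ e, Ω → Yt e) (k : Fin m) :
    Ω → ((∀ e : {e : ε // tl e = k}, Tt e.1) × (∀ e : {e : ε // hd e = k}, Yt e.1)) :=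
  fun ω => (fun e => Te e.1 ω, fun e => Ye e.1 ω)

/-- The tuple `X_B = (X_k : k ∈ B)` of terminal variables of a Tree-PIN source. -/
def termTuple {Ω : Type*} {m : ℕ} {ε : Type*} (tl hd : ε → Fin m)
    {Tt Yt : ε → Type*} (Te : ∀ e, Ω → Tt e) (Ye : ∀ e, Ω → Yt e)
    (B : Finset (Fin m)) :
    Ω → (∀ k : B, ((∀ e : {e : ε // tl e = k.1}, Tt e.1) ×
      (∀ e : {e : ε // hd e = k.1}, Yt e.1))) :=
  fun ω k => termRV tl hd Te Ye k.1 ω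

/-- The edge pairs `(T_e, Y_e)` are mutually independent across edges. -/
def IndepEdgePairs {Ω : Type*} [Fintype Ω] {ε : Type*} [Fintype ε]
    {Tt Yt : ε → Type*} [∀ e, Fintype (Tt e)] [∀ e, DecidableEq (Tt e)]
    [∀ e, Fintype (Yt e)] [∀ e, DecidableEq (Yt e)]
    (p : Ω → ℝ) (Te : ∀ e, Ω → Tt e) (Ye : ∀ e, Ω → Yt e) : Prop :=
  ∀ x : ∀ e, Tt e × Yt e,
    probOf p (fun ω e => (Te e ω, Ye e ω)) x
      = ∏ e : ε, probOf p (fun ω => (Te e ω, Ye e ω)) (x e)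

/-- The edge triples `(T_e, Y_e, Z_e)` are mutually independent across edges. -/
def IndepEdgeTriples {Ω : Type*} [Fintype Ω] {ε : Type*} [Fintype ε]
    {Tt Yt Zt : ε → Type*} [∀ e, Fintype (Tt e)] [∀ e, DecidableEq (Tt e)]
    [∀ e, Fintype (Yt e)] [∀ e, DecidableEq (Yt e)]
    [∀ e, Fintype (Zt e)] [∀ e, DecidableEq (Zt e)]
    (p : Ω → ℝ) (Te : ∀ e, Ω → Tt e) (Ye : ∀ e, Ω → Yt e) (Ze : ∀ e, Ω → Zt e) :
    Prop :=
  ∀ x : ∀ e, Tt e × Yt e × Zt e,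
    probOf p (fun ω e => (Te e ω, Ye e ω, Ze e ω)) x
      = ∏ e : ε, probOf p (fun ω => (Te e ω, Ye e ω, Ze e ω)) (x e)

open Classical in
theorem entropy_eq_neg_sum_mul_log {Ω α : Type*} [Fintype Ω] [Fintype α] [DecidableEq α]
    (p : Ω → ℝ) (X : Ω → α) :
    entropy p X = -∑ ω, p ω * Real.log (∑ ω' with X ω' = X ω, p ω') := by
  unfold entropy Real.negMulLog probOf
  rw [← Finset.sum_fiberwise Finset.univ X
    (fun ω => p ω * Real.log (∑ ω' with X ω' = X ω, p ω')), ← Finset.sum_neg_distrib]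
  refine Finset.sum_congr rfl fun a _ => ?_
  rw [neg_mul, Finset.sum_mul]
  congr 1
  refine Finset.sum_congr (by congr) fun ω hω => ?_
  obtain rfl : X ω = a := by simpa using hω
  congr!

/-- Random variables that determine each other have the same entropy. -/
theorem entropy_congr {Ω α β : Type*} [Fintype Ω] [Fintype α] [DecidableEq α]
    [Fintype β] [DecidableEq β] (p : Ω → ℝ) {X : Ω → α} {Y : Ω → β}
    (h : ∀ ω ω', X ω = X ω' ↔ Y ω = Y ω') : entropy p X = entropy p Y := by
  simp only [entropy_eq_neg_sum_mul_log, h]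

/-- Conditional mutual information in terms of variables `A`, `B`, `C`, `D` carrying the same
information as `(X, Z)`, `(Y, Z)`, `(X, Y, Z)` and `Z`. -/
theorem condMutualInfo_eq_of_iff {Ω α β γ δ₁ δ₂ δ₃ δ₄ : Type*} [Fintype Ω]
    [Fintype α] [DecidableEq α] [Fintype β] [DecidableEq β] [Fintype γ] [DecidableEq γ]
    [Fintype δ₁] [DecidableEq δ₁] [Fintype δ₂] [DecidableEq δ₂]
    [Fintype δ₃] [DecidableEq δ₃] [Fintype δ₄] [DecidableEq δ₄]
    (p : Ω → ℝ) {X : Ω → α} {Y : Ω → β} {Z : Ω → γ}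
    {A : Ω → δ₁} {B : Ω → δ₂} {C : Ω → δ₃} {D : Ω → δ₄}
    (hA : ∀ ω ω', X ω = X ω' ∧ Z ω = Z ω' ↔ A ω = A ω')
    (hB : ∀ ω ω', Y ω = Y ω' ∧ Z ω = Z ω' ↔ B ω = B ω')
    (hC : ∀ ω ω', X ω = X ω' ∧ Y ω = Y ω' ∧ Z ω = Z ω' ↔ C ω = C ω')
    (hD : ∀ ω ω', Z ω = Z ω' ↔ D ω = D ω') :
    condMutualInfo p X Y Z = entropy p A + entropy p B - entropy p C - entropy p D := by
  unfold condMutualInfo condEntropy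
  rw [entropy_congr p (X := fun ω => (X ω, Z ω)) (Y := A) (by simpa using hA),
    entropy_congr p (X := fun ω => (Y ω, Z ω)) (Y := B) (by simpa using hB),
    entropy_congr p (X := fun ω => ((X ω, Y ω), Z ω)) (Y := C) (by simpa [and_assoc] using hC),
    entropy_congr p (X := Z) (Y := D) hD]
  ring

theorem probOf_comp {Ω α β : Type*} [Fintype Ω] [Fintype α] [DecidableEq α]
    [DecidableEq β] (p : Ω → ℝ) (X : Ω → α) (g : α → β) (b : β) :
    probOf p (fun ω => g (X ω)) b = ∑ a with g a = b, probOf p X a := by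
  unfold probOf
  rw [Finset.sum_filter, ← Finset.sum_fiberwise Finset.univ X, Finset.sum_filter]
  refine Finset.sum_congr rfl fun a _ => ?_
  split_ifs with h
  · exact Finset.sum_congr rfl fun ω hω => by simp_all
  · exact Finset.sum_eq_zero fun ω hω => by simp_all

/-- Applying a function to each member of an independent family keeps it independent. -/
theorem probOf_pi_comp {Ω ε : Type*} [Fintype Ω] [Fintype ε] [DecidableEq ε]
    {α β : ε → Type*} [∀ f, Fintype (α f)] [∀ f, DecidableEq (α f)] [∀ f, DecidableEq (β f)]
    (p : Ω → ℝ) (W : ∀ f, Ω → α f) (g : ∀ f, α f → β f)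
    (h : ∀ x, probOf p (fun ω f => W f ω) x = ∏ f, probOf p (W f) (x f)) (y : ∀ f, β f) :
    probOf p (fun ω f => g f (W f ω)) y = ∏ f, probOf p (fun ω => g f (W f ω)) (y f) := by
  rw [probOf_comp p (fun ω f => W f ω) (fun x f => g f (x f))]
  simp only [probOf_comp p _ (g _), h]
  rw [Finset.prod_univ_sum]
  refine Finset.sum_congr ?_ fun _ _ => rfl
  ext x
  simp [funext_iff]

theorem entropy_pi {Ω ε : Type*} [Fintype Ω] [Fintype ε] [DecidableEq ε]
    {α : ε → Type*} [∀ f, Fintype (α f)] [∀ f, DecidableEq (α f)]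
    (p : Ω → ℝ) (hp : ∀ ω, 0 ≤ p ω) (W : ∀ f, Ω → α f)
    (h : ∀ x, probOf p (fun ω f => W f ω) x = ∏ f, probOf p (W f) (x f)) :
    entropy p (fun ω f => W f ω) = ∑ f, entropy p (W f) := by
  classical
  simp only [entropy_eq_neg_sum_mul_log]
  rw [Finset.sum_neg_distrib, Finset.sum_comm]
  congr 1
  refine Finset.sum_congr rfl fun ω _ => ?_
  rw [← Finset.mul_sum]
  rcases (hp ω).eq_or_lt with h0 | h0
  · simp [← h0]
  have hω := h (fun f => W f ω)
  unfold probOf at hω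
  congr 1
  rw [← Real.log_prod]
  · exact congrArg Real.log hω
  · intro f _
    refine (h0.trans_le ?_).ne'
    exact Finset.single_le_sum (f := p) (fun _ _ => hp _) (by simp)

/-- The part of the triple `(T_f, Y_f, Z_f)` known to the wiretapper together with an observer
who sees `T_f` if `a` holds and `Y_f` if `c` holds. -/
def maskTriple {T Y Z : Type*} (a c : Prop) [Decidable a] [Decidable c] (x : T × Y × Z) :
    Option T × Option Y × Z :=
  (if a then some x.1 else none, if c then some x.2.1 else none, x.2.2)

theorem maskTriple_eq_iff {T Y Z : Type*} {a c : Prop} [Decidable a] [Decidable c]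
    {x y : T × Y × Z} : maskTriple a c x = maskTriple a c y ↔
      (a → x.1 = y.1) ∧ (c → x.2.1 = y.2.1) ∧ x.2.2 = y.2.2 := by
  unfold maskTriple
  split_ifs <;> simp_all

theorem termTuple_eq_iff {Ω : Type*} {m : ℕ} {ε : Type*} {tl hd : ε → Fin m}
    {Tt Yt : ε → Type*} {Te : ∀ e, Ω → Tt e} {Ye : ∀ e, Ω → Yt e} {B : Finset (Fin m)}
    {ω ω' : Ω} : termTuple tl hd Te Ye B ω = termTuple tl hd Te Ye B ω' ↔
      (∀ f, tl f ∈ B → Te f ω = Te f ω') ∧ (∀ f, hd f ∈ B → Ye f ω = Ye f ω') := by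
  simp only [termTuple, termRV, funext_iff, Prod.mk.injEq, Subtype.forall]
  constructor
  · intro h
    exact ⟨fun f hf => (h _ hf).1 f rfl, fun f hf => (h _ hf).2 f rfl⟩
  · rintro ⟨h₁, h₂⟩ k hk
    exact ⟨fun f hf => h₁ f (hf ▸ hk), fun f hf => h₂ f (hf ▸ hk)⟩

theorem tl_mem_iff_hd_mem_of_ne {m : ℕ} {ε : Type*} {tl hd : ε → Fin m}
    (hloop : ∀ e, tl e ≠ hd e) (hinj : Function.Injective (fun e => s(tl e, hd e)))
    {e f : ε} (hf : f ≠ e) {B : Finset (Fin m)} {r : Fin m}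
    (hB : ∀ k, k ∈ B ↔ ((graphOf tl hd).deleteEdges {s(tl e, hd e)}).Reachable r k) :
    tl f ∈ B ↔ hd f ∈ B := by
  have hadj : ((graphOf tl hd).deleteEdges {s(tl e, hd e)}).Adj (tl f) (hd f) := by
    rw [SimpleGraph.deleteEdges_adj]
    refine ⟨?_, fun h => hf (hinj h)⟩
    rw [graphOf, SimpleGraph.fromRel_adj]
    exact ⟨hloop f, Or.inl ⟨f, rfl, rfl⟩⟩
  rw [hB, hB]
  exact ⟨fun h => h.trans hadj.reachable, fun h => h.trans hadj.symm.reachable⟩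

theorem not_reachable_deleteEdges_of_isAcyclic {m : ℕ} {ε : Type*} {tl hd : ε → Fin m}
    (hG : (graphOf tl hd).IsAcyclic) {e : ε} (hloop : tl e ≠ hd e) :
    ¬ ((graphOf tl hd).deleteEdges {s(tl e, hd e)}).Reachable (tl e) (hd e) := by
  have hadj : (graphOf tl hd).Adj (tl e) (hd e) := by
    rw [graphOf, SimpleGraph.fromRel_adj]
    exact ⟨hloop, Or.inl ⟨e, rfl, rfl⟩⟩
  exact SimpleGraph.isBridge_iff.1 (SimpleGraph.isAcyclic_iff_forall_adj_isBridge.1 hG hadj)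

theorem wiretapped_treePIN_cut_condMutualInfo_eq_edge_condMutualInfo
    {Ω : Type*} [Fintype Ω] {m : ℕ} {ε : Type*} [Fintype ε] [DecidableEq ε]
    (tl hd : ε → Fin m)
    {Tt Yt Zt : ε → Type*} [∀ e, Fintype (Tt e)] [∀ e, DecidableEq (Tt e)]
    [∀ e, Fintype (Yt e)] [∀ e, DecidableEq (Yt e)]
    [∀ e, Fintype (Zt e)] [∀ e, DecidableEq (Zt e)]
    (p : Ω → ℝ) (hp : ∀ ω, 0 ≤ p ω) (hp1 : ∑ ω : Ω, p ω = 1)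
    (Te : ∀ e, Ω → Tt e) (Ye : ∀ e, Ω → Yt e) (Ze : ∀ e, Ω → Zt e)
    -- the underlying undirected graph is a tree with edge set `ε`
    (htree : (graphOf tl hd).IsTree)
    (hloop : ∀ e, tl e ≠ hd e)
    (hinj : Function.Injective (fun e => s(tl e, hd e)))
    -- the edge triples are mutually independent across edges
    (hindep : IndepEdgeTriples p Te Ye Ze)
    (e : ε) (Be : Finset (Fin m))
    -- `B_e` is the vertex set of one of the two connected components of the tree
    -- with the edge `e` removed
    (hBe : (∀ k, k ∈ Be ↔
        ((graphOf tl hd).deleteEdges {s(tl e, hd e)}).Reachable (tl e) k) ∨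
      (∀ k, k ∈ Be ↔
        ((graphOf tl hd).deleteEdges {s(tl e, hd e)}).Reachable (hd e) k)) :
    -- `I(X_{B_e} ; X_{B_e^c} | Z) = I(T_e ; Y_e | Z_e)`, where `Z = (Z_e : e ∈ E)`
    condMutualInfo p (termTuple tl hd Te Ye Be) (termTuple tl hd Te Ye Beᶜ)
        (fun ω (f : ε) => Ze f ω)
      = condMutualInfo p (Te e) (Ye e) (Ze e) := by
  have hside : ∀ f, f ≠ e → (tl f ∈ Be ↔ hd f ∈ Be) := fun f hf =>
    hBe.elim (tl_mem_iff_hd_mem_of_ne hloop hinj hf) (tl_mem_iff_hd_mem_of_ne hloop hinj hf)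
  have hcut : tl e ∈ Be ↔ hd e ∉ Be := by
    have hnr := not_reachable_deleteEdges_of_isAcyclic htree.isAcyclic (hloop e)
    rcases hBe with h | h
    · simp [h, hnr]
    · rw [SimpleGraph.reachable_comm] at hnr
      simp [h, hnr]
  let V (a c : ε → Prop) [DecidablePred a] [DecidablePred c] (f : ε) (ω : Ω) :=
    maskTriple (a f) (c f) (Te f ω, Ye f ω, Ze f ω)
  have hV (a c : ε → Prop) [DecidablePred a] [DecidablePred c] :
      entropy p (fun ω f => V a c f ω) = ∑ f, entropy p (V a c f) :=
    entropy_pi p hp _ (probOf_pi_comp p (fun f ω => (Te f ω, Ye f ω, Ze f ω))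
      (fun f => maskTriple (a f) (c f)) hindep)
  have hTuple : condMutualInfo p (termTuple tl hd Te Ye Be) (termTuple tl hd Te Ye Beᶜ)
      (fun ω (f : ε) => Ze f ω) =
      entropy p (fun ω f => V (tl · ∈ Be) (hd · ∈ Be) f ω)
      + entropy p (fun ω f => V (tl · ∉ Be) (hd · ∉ Be) f ω)
      - entropy p (fun ω f => V (fun _ => True) (fun _ => True) f ω)
      - entropy p (fun ω f => V (fun _ => False) (fun _ => False) f ω) := by
    refine condMutualInfo_eq_of_iff p (fun ω ω' => ?_) (fun ω ω' => ?_) (fun ω ω' => ?_)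
      fun ω ω' => by simp [V, funext_iff, maskTriple_eq_iff]
    all_goals
      simp only [termTuple_eq_iff, Finset.mem_compl]
      simp only [V, funext_iff, maskTriple_eq_iff, forall_and, and_assoc]
    clear * -
    grind
  rw [hTuple, hV, hV, hV, hV, ← Finset.sum_add_distrib, ← Finset.sum_sub_distrib,
    ← Finset.sum_sub_distrib, Finset.sum_eq_single_of_mem e (Finset.mem_univ e)]
  · by_cases ht : tl e ∈ Be
    · have hh := hcut.1 ht
      exact (condMutualInfo_eq_of_iff p (by simp [V, maskTriple_eq_iff, ht, hh])
        (by simp [V, maskTriple_eq_iff, ht, hh]) (by simp [V, maskTriple_eq_iff])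
        (by simp [V, maskTriple_eq_iff])).symm
    · have hh : hd e ∈ Be := by tauto
      rw [add_comm (entropy p _)]
      exact (condMutualInfo_eq_of_iff p (by simp [V, maskTriple_eq_iff, ht, hh])
        (by simp [V, maskTriple_eq_iff, ht, hh]) (by simp [V, maskTriple_eq_iff])
        (by simp [V, maskTriple_eq_iff])).symm
  · intro f _ hf
    by_cases ht : tl f ∈ Be
    · have hh := (hside f hf).1 ht
      simp [V, ht, hh]
    · have hh := mt (hside f hf).2 ht
      simp [V, ht, hh]
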